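/- For every function y : ℝ → ℂ that is continuously differentiable on [-1,1], one has ∫_{-1}^{1} | y(x) · ∫₀ˣ ( y(s)·conj(y'(s)) − conj(y(s))·y'(s) ) ds |² dx ≤ 4 · (∫_{-1}^{1} |y(x)|² dx)² · (∫_{-1}^{1} |y'(x)|² dx). -/

import Mathlib

open MeasureTheory Set

/-- Cauchy–Schwarz for interval integrals of continuous real functions. -/
theorem sq_intervalIntegral_mul_le {a b : ℝ} (hab : a ≤ b) {f g : ℝ → ℝ}
    (hf : ContinuousOn f (Icc a b)) (hg : ContinuousOn g (Icc a b)) :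
    (∫ x in a..b, f x * g x) ^ 2 ≤ (∫ x in a..b, f x ^ 2) * ∫ x in a..b, g x ^ 2 := by
  have hff : IntervalIntegrable (fun x => f x ^ 2) volume a b :=
    (hf.pow 2).intervalIntegrable_of_Icc hab
  have hgg : IntervalIntegrable (fun x => g x ^ 2) volume a b :=
    (hg.pow 2).intervalIntegrable_of_Icc hab
  have hfg : IntervalIntegrable (fun x => f x * g x) volume a b :=
    (hf.mul hg).intervalIntegrable_of_Icc hab
  have key : ∀ t : ℝ, 0 ≤ (∫ x in a..b, f x ^ 2) * (t * t) +
      (2 * ∫ x in a..b, f x * g x) * t + ∫ x in a..b, g x ^ 2 := by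
    intro t
    have h0 : 0 ≤ ∫ x in a..b, (t * f x + g x) ^ 2 :=
      intervalIntegral.integral_nonneg hab fun x _ => sq_nonneg _
    have h1 : ∫ x in a..b, (t * f x + g x) ^ 2 =
        ∫ x in a..b, (t * t * f x ^ 2 + 2 * t * (f x * g x) + g x ^ 2) := by
      congr 1; ext x; ring
    rw [h1, intervalIntegral.integral_add ((hff.const_mul _).add (hfg.const_mul _)) hgg,
      intervalIntegral.integral_add (hff.const_mul _) (hfg.const_mul _),
      intervalIntegral.integral_const_mul, intervalIntegral.integral_const_mul] at h0
    linarith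
  have hdisc := discrim_le_zero key
  unfold discrim at hdisc
  linarith

/-- For `y` continuously differentiable on `[-1,1]`,
`∫ |y(x) ∫₀ˣ (y conj(y') - conj(y) y') ds|² dx ≤ 4 (∫|y|²)² (∫|y'|²)`. -/
theorem stmt_6 (y y' : ℝ → ℂ)
    (hd : ∀ x ∈ Set.Icc (-1:ℝ) 1, HasDerivAt y (y' x) x)
    (hc : ContinuousOn y' (Set.Icc (-1:ℝ) 1)) :
    (∫ x in (-1:ℝ)..1,
        norm (y x *
          ∫ s in (0:ℝ)..x,
            (y s * (starRingEnd ℂ) (y' s) - (starRingEnd ℂ) (y s) * y' s)) ^ 2) ≤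
      4 * (∫ x in (-1:ℝ)..1, norm (y x) ^ 2) ^ 2 *
        (∫ x in (-1:ℝ)..1, norm (y' x) ^ 2) := by
  have hle : (-1:ℝ) ≤ 1 := by norm_num
  have hy : ContinuousOn y (Icc (-1:ℝ) 1) := fun x hx => (hd x hx).continuousAt.continuousWithinAt
  have hcs := sq_intervalIntegral_mul_le hle hy.norm hc.norm
  have hprod : IntegrableOn (fun s => 2 * (‖y s‖ * ‖y' s‖)) (Ioc (-1:ℝ) 1) :=
    ((continuousOn_const.mul (hy.norm.mul hc.norm)).integrableOn_Icc).mono_set Ioc_subset_Icc_self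
  have hinner : ∀ x ∈ Ioc (-1:ℝ) 1,
      ‖∫ s in (0:ℝ)..x, (y s * (starRingEnd ℂ) (y' s) - (starRingEnd ℂ) (y s) * y' s)‖ ≤
        2 * ∫ s in (-1:ℝ)..1, ‖y s‖ * ‖y' s‖ := by
    intro x hx
    have hsub : uIoc 0 x ⊆ Ioc (-1:ℝ) 1 :=
      Ioc_subset_Ioc (le_min (by norm_num) hx.1.le) (max_le (by norm_num) hx.2)
    calc _ ≤ ∫ s in uIoc 0 x, ‖y s * (starRingEnd ℂ) (y' s) - (starRingEnd ℂ) (y s) * y' s‖ :=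
          intervalIntegral.norm_integral_le_integral_norm_uIoc
      _ ≤ ∫ s in uIoc 0 x, 2 * (‖y s‖ * ‖y' s‖) := by
          refine integral_mono_of_nonneg (.of_forall fun s => norm_nonneg _)
            (hprod.mono_set hsub) (.of_forall fun s => ?_)
          refine (norm_sub_le _ _).trans_eq ?_
          simp only [norm_mul, RCLike.norm_conj]
          ring
      _ ≤ ∫ s in Ioc (-1:ℝ) 1, 2 * (‖y s‖ * ‖y' s‖) :=
          setIntegral_mono_set hprod (.of_forall fun s => by positivity) hsub.eventuallyLE
      _ = _ := by rw [← intervalIntegral.integral_of_le hle, intervalIntegral.integral_const_mul]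
  have hsq : IntervalIntegrable (fun x => ‖y x‖ ^ 2) volume (-1) 1 :=
    (hy.norm.pow 2).intervalIntegrable_of_Icc hle
  have hA : 0 ≤ ∫ x in (-1:ℝ)..1, ‖y x‖ ^ 2 :=
    intervalIntegral.integral_nonneg hle fun x _ => sq_nonneg _
  have hmain := intervalIntegral.norm_integral_le_of_norm_le hle (μ := volume)
    (f := fun x => ‖y x * ∫ s in (0:ℝ)..x,
      (y s * (starRingEnd ℂ) (y' s) - (starRingEnd ℂ) (y s) * y' s)‖ ^ 2)
    (.of_forall fun x hx => by
      rw [Real.norm_of_nonneg (sq_nonneg _), norm_mul, mul_pow]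
      exact mul_le_mul_of_nonneg_left (pow_le_pow_left₀ (norm_nonneg _) (hinner x hx) 2)
        (sq_nonneg _)) (hsq.mul_const _)
  rw [intervalIntegral.integral_mul_const] at hmain
  refine (Real.le_norm_self _).trans (hmain.trans ?_)
  nlinarith [mul_le_mul_of_nonneg_left hcs hA]
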